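/- arXiv:0806.0052 — 2 statements merged into one kernel-verified Lean document; each statement's English description precedes it below -/
import Mathlib

section
/- Let f ∈ C_0^∞(ℝⁿ) (a smooth compactly supported function on ℝⁿ, with Lebesgue measure). Then there is a constant c > 0 depending only on n such that for all t > 0: (1/t)∫₀ᵗ [f*(s) − f*(t)] ds ≤ c t^{1/n} (1/t)∫₀ᵗ |∇f|*(s) ds, where f* and |∇f|* are the decreasing rearrangements of f and of the Euclidean norm of the gradient of f. -/
open MeasureTheory Set

/-- Decreasing rearrangement of `h` with respect to the measure `μ`:
`h*(t) = inf {λ ≥ 0 : μ({x : |h(x)| > λ}) ≤ t}`. -/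
noncomputable def decRearr {X : Type*} [MeasurableSpace X] (μ : Measure X) (h : X → ℝ)
    (t : ℝ) : ℝ :=
  sInf {l : ℝ | 0 ≤ l ∧ μ {x | l < |h x|} ≤ ENNReal.ofReal t}

open scoped ENNReal NNReal

lemma aux_set_nonempty {X : Type*} [MeasurableSpace X] (μ : Measure X) {h : X → ℝ} {M : ℝ}
    (hM : ∀ x, |h x| ≤ M) (hM0 : 0 ≤ M) (t : ℝ) :
    M ∈ {l : ℝ | 0 ≤ l ∧ μ {x | l < |h x|} ≤ ENNReal.ofReal t} := by
  refine ⟨hM0, ?_⟩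
  have : {x | M < |h x|} = ∅ := by
    ext x; simpa using hM x
  simp [this]

lemma aux_bdd {X : Type*} [MeasurableSpace X] (μ : Measure X) (h : X → ℝ) (t : ℝ) :
    BddBelow {l : ℝ | 0 ≤ l ∧ μ {x | l < |h x|} ≤ ENNReal.ofReal t} :=
  ⟨0, fun _ hl => hl.1⟩

lemma decRearr_nonneg {X : Type*} [MeasurableSpace X] (μ : Measure X) (h : X → ℝ) (t : ℝ) :
    0 ≤ decRearr μ h t := Real.sInf_nonneg fun _ hl => hl.1

lemma decRearr_le {X : Type*} [MeasurableSpace X] (μ : Measure X) {h : X → ℝ} {M : ℝ}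
    (hM : ∀ x, |h x| ≤ M) (hM0 : 0 ≤ M) (t : ℝ) : decRearr μ h t ≤ M :=
  csInf_le (aux_bdd μ h t) (aux_set_nonempty μ hM hM0 t)

lemma decRearr_antitone {X : Type*} [MeasurableSpace X] (μ : Measure X) {h : X → ℝ} {M : ℝ}
    (hM : ∀ x, |h x| ≤ M) (hM0 : 0 ≤ M) : Antitone (decRearr μ h) := by
  intro s t hst
  apply csInf_le_csInf (aux_bdd μ h t) ⟨M, aux_set_nonempty μ hM hM0 s⟩
  rintro l ⟨h0, h1⟩
  exact ⟨h0, h1.trans (ENNReal.ofReal_le_ofReal hst)⟩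

/-- The infimum is attained. -/
lemma decRearr_meas_le {X : Type*} [MeasurableSpace X] (μ : Measure X) {h : X → ℝ} {M : ℝ}
    (hM : ∀ x, |h x| ≤ M) (hM0 : 0 ≤ M) (t : ℝ) :
    μ {x | decRearr μ h t < |h x|} ≤ ENNReal.ofReal t := by
  have hU : {x | decRearr μ h t < |h x|} =
      ⋃ k : ℕ, {x | decRearr μ h t + 1 / ((k : ℝ) + 1) < |h x|} := by
    ext x
    simp only [mem_ofPred_eq, mem_iUnion]
    constructor
    · intro hx
      obtain ⟨k, hk⟩ := exists_nat_one_div_lt (sub_pos.2 hx)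
      exact ⟨k, by linarith⟩
    · rintro ⟨k, hk⟩
      have : (0 : ℝ) < 1 / ((k : ℝ) + 1) := by positivity
      linarith
  have hmono : Monotone fun k : ℕ => {x | decRearr μ h t + 1 / ((k : ℝ) + 1) < |h x|} := by
    intro j k hjk x hx
    simp only [mem_ofPred_eq] at hx ⊢
    have : 1 / ((k : ℝ) + 1) ≤ 1 / ((j : ℝ) + 1) := by gcongr
    linarith
  rw [hU, hmono.measure_iUnion]
  refine iSup_le fun k => ?_
  have hpos : (0 : ℝ) < 1 / ((k : ℝ) + 1) := by positivity
  obtain ⟨l, hl, hlt⟩ := exists_lt_of_csInf_lt ⟨M, aux_set_nonempty μ hM hM0 t⟩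
    (show sInf _ < decRearr μ h t + 1 / ((k : ℝ) + 1) from lt_add_of_pos_right _ hpos)
  refine le_trans (measure_mono ?_) hl.2
  intro x hx
  exact hlt.trans hx

lemma lt_decRearr_iff {X : Type*} [MeasurableSpace X] (μ : Measure X) {h : X → ℝ} {M : ℝ}
    (hM : ∀ x, |h x| ≤ M) (hM0 : 0 ≤ M) {r : ℝ} (hr : 0 ≤ r) (s : ℝ) :
    r < decRearr μ h s ↔ ENNReal.ofReal s < μ {x | r < |h x|} := by
  constructor
  · intro hlt
    by_contra hcon
    exact absurd (csInf_le (aux_bdd μ h s) ⟨hr, not_lt.1 hcon⟩) (not_le.2 hlt)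
  · intro hlt
    by_contra hcon
    refine absurd (le_trans (measure_mono ?_) (decRearr_meas_le μ hM hM0 s)) (not_le.2 hlt)
    intro x hx
    exact (not_lt.1 hcon).trans_lt hx

lemma decRearr_upper {X : Type*} [MeasurableSpace X] (μ : Measure X) {h : X → ℝ} {M : ℝ}
    (hh : Measurable h)
    (hM : ∀ x, |h x| ≤ M) (hM0 : 0 ≤ M) (t : ℝ) :
    ∫⁻ s in Ioo 0 t, ENNReal.ofReal (decRearr μ h s - decRearr μ h t) ≤
      ∫⁻ x, ENNReal.ofReal (max (|h x| - decRearr μ h t) 0) ∂μ := by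
  have hmeas : Measurable (decRearr μ h) := (decRearr_antitone μ hM hM0).measurable
  rw [lintegral_eq_lintegral_meas_lt, lintegral_eq_lintegral_meas_lt]
  · refine setLIntegral_mono' measurableSet_Ioi fun r hr => ?_
    have hr : 0 < r := hr
    have hl := decRearr_nonneg μ h t
    set L := decRearr μ h t with hL
    have h1 : {a | r < max (|h a| - L) 0} = {a | r + L < |h a|} := by
      ext a
      simp only [mem_ofPred_eq, lt_max_iff]
      constructor
      · rintro (h | h) <;> linarith
      · intro h; left; linarith
    rw [h1, Measure.restrict_apply (measurableSet_lt measurable_const (hmeas.sub_const _))]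
    by_cases hT : μ {a | r + L < |h a|} = ∞
    · rw [hT]; exact le_top
    have : {a | r < decRearr μ h a - L} ∩ Ioo 0 t ⊆
        Ioo 0 (μ {a | r + L < |h a|}).toReal := by
      rintro s ⟨hs, hs0, -⟩
      have hs : r < decRearr μ h s - L := hs
      refine ⟨hs0, ?_⟩
      have := (lt_decRearr_iff μ hM hM0 (by positivity : 0 ≤ r + L) s).1 (by linarith)
      exact (ENNReal.ofReal_lt_iff_lt_toReal hs0.le hT).1 this
    refine (measure_mono this).trans ?_
    rw [Real.volume_Ioo, sub_zero, ENNReal.ofReal_toReal hT]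
  · exact Filter.Eventually.of_forall fun x => le_max_right _ _
  · exact (by fun_prop : Measurable _).aemeasurable
  · refine (ae_restrict_iff' measurableSet_Ioo).2 (Filter.Eventually.of_forall fun s hs => ?_)
    exact sub_nonneg.2 (decRearr_antitone μ hM hM0 hs.2.le)
  · exact (hmeas.sub_const _).aemeasurable

lemma decRearr_lower {X : Type*} [MeasurableSpace X] (μ : Measure X) {h : X → ℝ} {M : ℝ}
    (hh : Measurable h)
    (hM : ∀ x, |h x| ≤ M) (hM0 : 0 ≤ M) (t : ℝ) (E : Set X)
    (hEt : μ E ≤ ENNReal.ofReal t) :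
    ∫⁻ x in E, ENNReal.ofReal |h x| ∂μ ≤
    ∫⁻ s in Ioo 0 t, ENNReal.ofReal (decRearr μ h s) := by
  have hmeas : Measurable (decRearr μ h) := (decRearr_antitone μ hM hM0).measurable
  rw [lintegral_eq_lintegral_meas_lt, lintegral_eq_lintegral_meas_lt]
  · refine setLIntegral_mono' measurableSet_Ioi fun r hr => ?_
    have hr : 0 < r := hr
    rw [Measure.restrict_apply (measurableSet_lt measurable_const (by fun_prop)),
      Measure.restrict_apply (measurableSet_lt measurable_const hmeas)]
    set m := μ ({a | r < |h a|} ∩ E) with hm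
    have hmt : m ≤ ENNReal.ofReal t := (measure_mono inter_subset_right).trans hEt
    have hmf : m ≠ ∞ := ne_top_of_le_ne_top ENNReal.ofReal_ne_top hmt
    have : Ioo 0 m.toReal ⊆ {a | r < decRearr μ h a} ∩ Ioo 0 t := by
      rintro s ⟨hs0, hs⟩
      have hs' := (ENNReal.ofReal_lt_iff_lt_toReal hs0.le hmf).2 hs
      refine ⟨?_, hs0, ?_⟩
      · exact (lt_decRearr_iff μ hM hM0 hr.le s).2
          (hs'.trans_le (measure_mono inter_subset_left))
      · by_contra hc
        exact absurd (hs'.trans_le hmt) (not_lt.2 (ENNReal.ofReal_le_ofReal (not_lt.1 hc)))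
    refine le_trans ?_ (measure_mono this)
    rw [Real.volume_Ioo, sub_zero, ENNReal.ofReal_toReal hmf]
  · exact Filter.Eventually.of_forall fun x => decRearr_nonneg _ _ _
  · exact hmeas.aemeasurable
  · exact Filter.Eventually.of_forall fun x => abs_nonneg _
  · exact (by fun_prop : Measurable _).aemeasurable

lemma sob_one (u : EuclideanSpace ℝ (Fin 1) → ℝ) (hu : ContDiff ℝ 1 u)
    (hc : HasCompactSupport u) (x : EuclideanSpace ℝ (Fin 1)) :
    ‖u x‖ₑ ≤ ∫⁻ y, ‖fderiv ℝ u y‖ₑ := by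
  let e : ℝ ≃ₗᵢ[ℝ] EuclideanSpace ℝ (Fin 1) := (OrthonormalBasis.singleton (Fin 1) ℝ).repr
  have he := e.measurePreserving
  have h1 : ContDiff ℝ 1 (u ∘ e) := hu.comp e.contDiff
  have h2 : HasCompactSupport (u ∘ e) := hc.comp_homeomorph e.toHomeomorph
  have h3 := h2.enorm_le_lintegral_Ici_deriv h1 (e.symm x)
  simp only [Function.comp_apply, LinearIsometryEquiv.apply_symm_apply] at h3
  refine h3.trans (le_trans (setLIntegral_le_lintegral _ _) ?_)
  rw [← he.lintegral_comp_emb e.toHomeomorph.measurableEmbedding]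
  refine lintegral_mono fun s => ?_
  have hd : HasDerivAt (u ∘ e) (fderiv ℝ u (e s) (e 1)) s := by
    have := ((hu.differentiable one_ne_zero) (e s)).hasFDerivAt.comp s
      (e.toContinuousLinearEquiv.hasFDerivAt)
    exact this.hasDerivAt
  simp only
  rw [hd.deriv]
  rw [enorm_le_iff_norm_le]
  refine (ContinuousLinearMap.le_opNorm _ _).trans ?_
  simp

lemma sob (n : ℕ) (hn : 0 < n) : ∃ C : ℝ≥0, ∀ u : EuclideanSpace ℝ (Fin n) → ℝ,
    ContDiff ℝ 1 u → HasCompactSupport u → ∀ E : Set (EuclideanSpace ℝ (Fin n)),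
    MeasurableSet E → (∀ x, x ∉ E → u x = 0) →
    ∫⁻ x, ‖u x‖ₑ ≤ C * (volume E) ^ ((1 : ℝ) / n) * ∫⁻ x, ‖fderiv ℝ u x‖ₑ := by
  rcases (Nat.succ_le_of_lt hn).eq_or_lt with h1 | h1
  · subst h1
    refine ⟨1, fun u hu hc E hE h0 => ?_⟩
    have : ∫⁻ x, ‖u x‖ₑ ≤ ∫⁻ x in E, (∫⁻ y, ‖fderiv ℝ u y‖ₑ) := by
      rw [← lintegral_indicator hE]
      refine lintegral_mono fun x => ?_
      by_cases hx : x ∈ E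
      · rw [indicator_of_mem hx]; exact sob_one u hu hc x
      · simp [h0 x hx]
    refine this.trans ?_
    simp [mul_comm]
  · have hn1 : (1 : ℝ) < n := by exact_mod_cast h1
    have hq := Real.HolderConjugate.conjExponent hn1
    set p := Real.conjExponent n with hp
    refine ⟨(lintegralPowLePowLIntegralFDerivConst
      (volume : Measure (EuclideanSpace ℝ (Fin n))) p) ^ (1 / p), fun u hu hc E hE h0 => ?_⟩
    have hp0 : 0 < p := hq.symm.pos
    have key := lintegral_pow_le_pow_lintegral_fderiv
      (volume : Measure (EuclideanSpace ℝ (Fin n))) hu hc (p := p) (by simpa using hq)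
    have hold := ENNReal.lintegral_mul_le_Lp_mul_Lq
      (volume : Measure (EuclideanSpace ℝ (Fin n))) hq.symm
      (f := fun x => ‖u x‖ₑ) (g := E.indicator 1)
      hu.continuous.enorm.aemeasurable (aemeasurable_const.indicator hE)
    have e1 : ∫⁻ x, ‖u x‖ₑ = ∫⁻ x, ((fun x => ‖u x‖ₑ) * E.indicator (1 : EuclideanSpace ℝ (Fin n) → ℝ≥0∞)) x := by
      refine lintegral_congr fun x => ?_
      by_cases hx : x ∈ E
      · simp [hx]
      · simp [h0 x hx]
    have e2 : ∫⁻ x, (E.indicator (1 : EuclideanSpace ℝ (Fin n) → ℝ≥0∞) x) ^ (n : ℝ) =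
        volume E := by
      rw [← lintegral_indicator_one hE]
      refine lintegral_congr fun x => ?_
      by_cases hx : x ∈ E
      · simp [hx]
      · simp [hx, hn.ne']
    rw [e2] at hold
    rw [e1]
    refine hold.trans ?_
    have := ENNReal.rpow_le_rpow key (by positivity : 0 ≤ 1 / p)
    rw [ENNReal.mul_rpow_of_nonneg _ _ (by positivity), ← ENNReal.rpow_mul,
      mul_one_div_cancel hp0.ne', ENNReal.rpow_one] at this
    rw [ENNReal.coe_rpow_of_nonneg _ (by positivity), mul_right_comm]
    gcongr

/-- A `C¹` approximation of the positive part. -/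
lemma exists_phi (ε : ℝ) (hε : 0 < ε) : ∃ φ : ℝ → ℝ, ContDiff ℝ 1 φ ∧ (∀ r ≤ 0, φ r = 0) ∧
    (∀ r, |deriv φ r| ≤ 1) ∧ (∀ r ≤ 0, deriv φ r = 0) ∧ ∀ r, max r 0 ≤ |φ r| + ε := by
  let k : ℝ → ℝ := fun s => max 0 (min 1 (s / ε))
  have hk : Continuous k := by fun_prop
  have hk0 : ∀ s ≤ 0, k s = 0 := fun s hs => by
    have : s / ε ≤ 0 := div_nonpos_of_nonpos_of_nonneg hs hε.le
    exact max_eq_left ((min_le_right _ _).trans this)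
  have hkn : ∀ s, 0 ≤ k s := fun s => le_max_left _ _
  have hk1 : ∀ s, ε ≤ s → k s = 1 := fun s hs => by
    have : 1 ≤ s / ε := (one_le_div hε).2 hs
    simp [k, min_eq_left this]
  have hd : ∀ r, HasDerivAt (fun u => ∫ x in (0 : ℝ)..u, k x) (k r) r := fun r =>
    (hk.integral_hasStrictDerivAt 0 r).hasDerivAt
  have hdd : deriv (fun u => ∫ x in (0 : ℝ)..u, k x) = k := funext fun r => (hd r).deriv
  refine ⟨fun u => ∫ x in (0 : ℝ)..u, k x, ?_, ?_, ?_, ?_, ?_⟩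
  · rw [contDiff_one_iff_deriv, hdd]
    exact ⟨fun r => (hd r).differentiableAt, hk⟩
  · intro r hr
    change ∫ x in (0 : ℝ)..r, k x = 0
    rw [intervalIntegral.integral_congr (g := fun _ => (0 : ℝ))]
    · simp
    · intro s hs
      rw [uIcc_of_ge hr] at hs
      exact hk0 s hs.2
  · intro r
    rw [hdd, abs_of_nonneg (hkn r)]
    exact max_le zero_le_one (min_le_left _ _)
  · intro r hr
    rw [hdd, hk0 r hr]
  · intro r
    rcases le_or_gt r ε with h | h
    · have := abs_nonneg (∫ x in (0 : ℝ)..r, k x)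
      apply max_le <;> linarith
    · have h1 : ∫ x in (0 : ℝ)..r, k x = (∫ x in (0 : ℝ)..ε, k x) + ∫ x in ε..r, k x :=
        (intervalIntegral.integral_add_adjacent_intervals
          (hk.intervalIntegrable _ _) (hk.intervalIntegrable _ _)).symm
      have h2 : ∫ x in ε..r, k x = r - ε := by
        rw [intervalIntegral.integral_congr (g := fun _ => (1 : ℝ))]
        · simp
        · intro s hs
          rw [uIcc_of_le h.le] at hs
          exact hk1 s hs.1
      have h3 : 0 ≤ ∫ x in (0 : ℝ)..ε, k x :=
        intervalIntegral.integral_nonneg hε.le fun s _ => hkn s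
      have h4 := le_abs_self (∫ x in (0 : ℝ)..r, k x)
      apply max_le <;> linarith

lemma half (n : ℕ) (hn : 0 < n) : ∃ C : ℝ≥0, ∀ f : EuclideanSpace ℝ (Fin n) → ℝ,
    ContDiff ℝ 1 f → HasCompactSupport f → ∀ L : ℝ, 0 ≤ L → ∀ t : ℝ, 0 < t →
    volume {x | L < f x} ≤ ENNReal.ofReal t →
    ∫⁻ x, ENNReal.ofReal (max (f x - L) 0) ≤
      C * (ENNReal.ofReal t) ^ ((1 : ℝ) / n) * ∫⁻ x in {x | L < f x}, ‖fderiv ℝ f x‖ₑ := by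
  obtain ⟨C, hC⟩ := sob n hn
  refine ⟨C, fun f hf hfc L hL t ht hE => ?_⟩
  set E := {x | L < f x} with hEdef
  have hEm : MeasurableSet E := measurableSet_lt measurable_const hf.continuous.measurable
  have hmain : ∀ ε : ℝ, 0 < ε → ∫⁻ x, ENNReal.ofReal (max (f x - L) 0) ≤
      C * (ENNReal.ofReal t) ^ ((1 : ℝ) / n) * (∫⁻ x in E, ‖fderiv ℝ f x‖ₑ)
        + ENNReal.ofReal ε * ENNReal.ofReal t := by
    intro ε hε
    obtain ⟨φ, h1, h2, h3, h4, h5⟩ := exists_phi ε hε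
    let u : EuclideanSpace ℝ (Fin n) → ℝ := fun x => φ (f x - L)
    have hu : ContDiff ℝ 1 u := h1.comp (hf.sub contDiff_const)
    have huc : HasCompactSupport u :=
      hfc.comp_left (g := fun y => φ (y - L)) (h2 _ (by linarith))
    have hu0 : ∀ x, x ∉ E → u x = 0 := fun x hx => h2 _ (by
      have : ¬ L < f x := hx
      linarith)
    have hder : ∀ x, HasFDerivAt u (deriv φ (f x - L) • fderiv ℝ f x) x := fun x =>
      ((h1.differentiable one_ne_zero) (f x - L)).hasDerivAt.comp_hasFDerivAt x
        (((hf.differentiable one_ne_zero) x).hasFDerivAt.sub_const L)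
    have hS := hC u hu huc E hEm hu0
    have hgrad : ∫⁻ x, ‖fderiv ℝ u x‖ₑ ≤ ∫⁻ x in E, ‖fderiv ℝ f x‖ₑ := by
      rw [← lintegral_indicator hEm]
      refine lintegral_mono fun x => ?_
      simp only
      rw [(hder x).fderiv]
      by_cases hx : x ∈ E
      · rw [indicator_of_mem hx, enorm_le_iff_norm_le, norm_smul]
        exact mul_le_of_le_one_left (norm_nonneg _) (h3 _)
      · have : ¬ L < f x := hx
        rw [← ofReal_norm, norm_smul, h4 _ (by linarith), norm_zero, zero_mul,
          ENNReal.ofReal_zero]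
        exact zero_le
    calc ∫⁻ x, ENNReal.ofReal (max (f x - L) 0)
        ≤ ∫⁻ x, (‖u x‖ₑ + E.indicator (fun _ => ENNReal.ofReal ε) x) := by
          refine lintegral_mono fun x => ?_
          by_cases hx : x ∈ E
          · rw [indicator_of_mem hx, ← ofReal_norm,
              ← ENNReal.ofReal_add (norm_nonneg _) hε.le]
            exact ENNReal.ofReal_le_ofReal (h5 _)
          · have : ¬ L < f x := hx
            rw [max_eq_right (by linarith)]
            simp
      _ = (∫⁻ x, ‖u x‖ₑ) + ENNReal.ofReal ε * volume E := by
          rw [lintegral_add_left hu.continuous.enorm.measurable, lintegral_indicator hEm]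
          simp
      _ ≤ _ := by
          refine add_le_add (hS.trans ?_) (by gcongr)
          gcongr
  refine ENNReal.le_of_forall_pos_le_add fun δ hδ _ => ?_
  have hδt : 0 < (δ : ℝ) / t := by positivity
  refine (hmain _ hδt).trans ?_
  rw [← ENNReal.ofReal_mul hδt.le, div_mul_cancel₀ _ ht.ne', ENNReal.ofReal_coe_nnreal]

lemma integrableOn_decRearr {X : Type*} [MeasurableSpace X] (μ : Measure X) {h : X → ℝ} {M : ℝ}
    (hM : ∀ x, |h x| ≤ M) (hM0 : 0 ≤ M) (t : ℝ) :
    IntegrableOn (decRearr μ h) (Ioo 0 t) := by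
  have hmeas : Measurable (decRearr μ h) := (decRearr_antitone μ hM hM0).measurable
  refine Measure.integrableOn_of_bounded (M := M) (by simp) hmeas.aestronglyMeasurable ?_
  refine Filter.Eventually.of_forall fun s => ?_
  rw [Real.norm_of_nonneg (decRearr_nonneg _ _ _)]
  exact decRearr_le μ hM hM0 s

/-- for `f ∈ C_0^∞(ℝⁿ)`,
`(1/t)∫₀ᵗ [f*(s) − f*(t)] ds ≤ c t^{1/n} (1/t)∫₀ᵗ |∇f|*(s) ds` for all `t > 0`,
with `c` depending only on `n`. -/
theorem stmt0 (n : ℕ) (hn : 0 < n) :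
    ∃ c > (0 : ℝ), ∀ f : EuclideanSpace ℝ (Fin n) → ℝ,
      ContDiff ℝ (⊤ : ℕ∞) f → HasCompactSupport f →
      ∀ t : ℝ, 0 < t →
        (1 / t) * ∫ s in Ioo (0 : ℝ) t, (decRearr volume f s - decRearr volume f t) ≤
          c * t ^ ((1 : ℝ) / n) *
            ((1 / t) * ∫ s in Ioo (0 : ℝ) t,
              decRearr volume (fun x => ‖fderiv ℝ f x‖) s) := by
  obtain ⟨C, hC⟩ := half n hn
  refine ⟨2 * C + 1, by positivity, fun f hf' hfc t ht => ?_⟩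
  have hf : ContDiff ℝ 1 f := hf'.of_le (by exact_mod_cast le_top)
  obtain ⟨M, hM⟩ := hfc.exists_bound_of_continuous hf.continuous
  have hM0 : 0 ≤ M := (norm_nonneg _).trans (hM 0)
  have hg : Continuous (fderiv ℝ f) := hf.continuous_fderiv one_ne_zero
  obtain ⟨M', hM'⟩ := (hfc.fderiv (𝕜 := ℝ)).exists_bound_of_continuous hg
  have hM0' : 0 ≤ M' := (norm_nonneg _).trans (hM' 0)
  have hM'' : ∀ x, |‖fderiv ℝ f x‖| ≤ M' := fun x => by rw [abs_norm]; exact hM' x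
  set L := decRearr volume f t with hL
  have hL0 : 0 ≤ L := decRearr_nonneg _ _ _
  have hE : volume {x | L < |f x|} ≤ ENNReal.ofReal t := decRearr_meas_le volume hM hM0 t
  have up := decRearr_upper volume hf.continuous.measurable hM hM0 t
  rw [← hL] at up
  have low : ∀ E : Set (EuclideanSpace ℝ (Fin n)), E ⊆ {x | L < |f x|} →
      ∫⁻ x in E, ‖fderiv ℝ f x‖ₑ ≤
        ∫⁻ s in Ioo 0 t, ENNReal.ofReal (decRearr volume (fun x => ‖fderiv ℝ f x‖) s) := by
    intro E hEs
    have := decRearr_lower volume hg.norm.measurable hM'' hM0' t E ((measure_mono hEs).trans hE)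
    simpa only [abs_norm, ofReal_norm] using this
  set J := ∫⁻ s in Ioo 0 t, ENNReal.ofReal (decRearr volume (fun x => ‖fderiv ℝ f x‖) s) with hJ
  have s1 : {x | L < f x} ⊆ {x | L < |f x|} := fun x hx =>
    lt_of_lt_of_le (show L < f x from hx) (le_abs_self _)
  have s2 : {x | L < -f x} ⊆ {x | L < |f x|} := fun x hx =>
    lt_of_lt_of_le (show L < -f x from hx) (neg_le_abs _)
  have b1 := (hC f hf hfc L hL0 t ht ((measure_mono s1).trans hE)).trans
    (mul_le_mul_right (low _ s1) _)
  have b2 := hC (fun x => -f x) hf.neg hfc.neg L hL0 t ht ((measure_mono s2).trans hE)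
  have b2' : ∫⁻ x in {x | L < -f x}, ‖fderiv ℝ (fun x => -f x) x‖ₑ ≤ J := by
    simpa using low _ s2
  have b3 := b2.trans (mul_le_mul_right b2' _)
  have tot : ∫⁻ s in Ioo 0 t, ENNReal.ofReal (decRearr volume f s - L) ≤
      ENNReal.ofReal 2 * C * (ENNReal.ofReal t) ^ ((1 : ℝ) / n) * J := by
    refine up.trans ?_
    have : ∫⁻ x, ENNReal.ofReal (max (|f x| - L) 0) ≤
        ∫⁻ x, (ENNReal.ofReal (max (f x - L) 0) + ENNReal.ofReal (max (-f x - L) 0)) := by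
      refine lintegral_mono fun x => ?_
      simp only
      rcases abs_choice (f x) with h | h <;> rw [h]
      · exact le_self_add
      · exact le_add_self
    refine this.trans ?_
    rw [lintegral_add_left
      (by have := hf.continuous; fun_prop : Measurable fun x => ENNReal.ofReal (max (f x - L) 0))]
    refine (add_le_add b1 b3).trans (le_of_eq ?_)
    rw [ENNReal.ofReal_ofNat]
    ring
  have hJi := integrableOn_decRearr (volume : Measure (EuclideanSpace ℝ (Fin n))) hM'' hM0' t
  have hfi := integrableOn_decRearr (volume : Measure (EuclideanSpace ℝ (Fin n))) hM hM0 t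
  set G := ∫ s in Ioo (0 : ℝ) t, decRearr volume (fun x => ‖fderiv ℝ f x‖) s with hG
  have hG0 : 0 ≤ G := integral_nonneg fun s => decRearr_nonneg _ _ _
  have hJG : J = ENNReal.ofReal G :=
    (ofReal_integral_eq_lintegral_ofReal hJi
      (Filter.Eventually.of_forall fun s => decRearr_nonneg _ _ _)).symm
  have hfi' : IntegrableOn (fun s => decRearr volume f s - L) (Ioo 0 t) :=
    hfi.sub (integrableOn_const (by simp))
  rw [← ofReal_integral_eq_lintegral_ofReal hfi'
    ((ae_restrict_iff' measurableSet_Ioo).2 (Filter.Eventually.of_forall fun s hs =>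
      sub_nonneg.2 (decRearr_antitone volume hM hM0 hs.2.le))), hJG,
    ENNReal.ofReal_rpow_of_pos ht, ← ENNReal.ofReal_coe_nnreal,
    ← ENNReal.ofReal_mul (by positivity), ← ENNReal.ofReal_mul (by positivity),
    ← ENNReal.ofReal_mul (by positivity), ENNReal.ofReal_le_ofReal_iff (by positivity)] at tot
  have hT : 0 ≤ t ^ ((1 : ℝ) / n) := by positivity
  calc _ ≤ (1 / t) * (2 * C * t ^ ((1 : ℝ) / n) * G) := by gcongr
    _ = (2 * C) * t ^ ((1 : ℝ) / n) * ((1 / t) * G) := by ring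
    _ ≤ _ := by gcongr; linarith
end

section
/- Let 1 ≤ p < ∞ and let f ∈ C_0^∞(ℝⁿ) (Lebesgue measure). Then there is a constant c > 0 depending only on n and p such that ‖f‖_{L¹(ℝⁿ)} ≤ c ‖f‖₀^{1/n + 1 − 1/p} ‖|∇f|‖_{L^p(ℝⁿ)}, where ‖f‖₀ denotes the Lebesgue measure of the support of f and |∇f| is the Euclidean norm of the gradient of f. -/
open MeasureTheory Set

theorem fk_ae {n : ℕ} (hn : 0 < n) (f : EuclideanSpace ℝ (Fin n) → ℝ) (hf : ContDiff ℝ 1 f) :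
    ∀ᵐ x ∂(volume.restrict (Function.support f)ᶜ), fderiv ℝ f x = 0 := by
  have : Nonempty (Fin n) := ⟨⟨0, hn⟩⟩
  have : Nontrivial (EuclideanSpace ℝ (Fin n)) := inferInstance
  obtain ⟨v, hv⟩ := exists_ne (0 : EuclideanSpace ℝ (Fin n))
  have hm : MeasurableSet (Function.support f)ᶜ :=
    (hf.continuous.isOpen_support.measurableSet).compl
  have happ : ApproximatesLinearOn (fun x => f x • v)
      (0 : EuclideanSpace ℝ (Fin n) →L[ℝ] EuclideanSpace ℝ (Fin n)) (Function.support f)ᶜ 0 := by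
    intro x hx y hy
    have h1 : f x = 0 := by simpa using hx
    have h2 : f y = 0 := by simpa using hy
    simp [h1, h2]
  have := happ.norm_fderiv_sub_le volume hm (fun x => (fderiv ℝ f x).smulRight v) (by
    intro x hx
    exact (((hf.differentiable one_ne_zero) x).hasFDerivAt.smul_const v).hasFDerivWithinAt)
  filter_upwards [this] with x hx
  simp only [sub_zero, nonpos_iff_eq_zero, nnnorm_eq_zero] at hx
  ext w
  have := congrArg (fun L => L w) hx
  simpa [hv] using this

theorem fk_holder {n : ℕ} (hn : 0 < n) (f : EuclideanSpace ℝ (Fin n) → ℝ) (hf : ContDiff ℝ 1 f)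
    (p : ENNReal) (hp : 1 ≤ p) :
    eLpNorm (fderiv ℝ f) 1 volume ≤ eLpNorm (fderiv ℝ f) p volume *
      volume (Function.support f) ^ (1 - 1 / p.toReal) := by
  have hm : MeasurableSet (Function.support f) := hf.continuous.isOpen_support.measurableSet
  have h1 : eLpNorm (fderiv ℝ f) 1 volume
      = eLpNorm (fderiv ℝ f) 1 (volume.restrict (Function.support f)) := by
    rw [eLpNorm_one_eq_lintegral_enorm, eLpNorm_one_eq_lintegral_enorm,
      ← lintegral_add_compl _ hm]
    have : ∫⁻ x in (Function.support f)ᶜ, ‖fderiv ℝ f x‖ₑ = 0 := by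
      rw [lintegral_congr_ae (g := fun _ => 0)]
      · simp
      · filter_upwards [fk_ae hn f hf] with x hx
        rw [hx]
        exact enorm_zero (E := EuclideanSpace ℝ (Fin n) →L[ℝ] ℝ)
    rw [this, add_zero]
  rw [h1]
  refine (eLpNorm_le_eLpNorm_mul_rpow_measure_univ hp
    (hf.continuous_fderiv one_ne_zero).aestronglyMeasurable).trans ?_
  simp only [Measure.restrict_apply_univ, ENNReal.toReal_one, div_one]
  gcongr
  exact Measure.restrict_le_self

theorem fk_sup (f : EuclideanSpace ℝ (Fin 1) → ℝ) (hf : ContDiff ℝ 1 f)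
    (hc : HasCompactSupport f) (x : EuclideanSpace ℝ (Fin 1)) :
    ‖f x‖ₑ ≤ eLpNorm (fderiv ℝ f) 1 volume := by
  let b := OrthonormalBasis.singleton (Fin 1) ℝ
  have hd : ∀ t, HasDerivAt (f ∘ b.repr) (fderiv ℝ f (b.repr t) (b.repr 1)) t := by
    intro t
    have h := ((hf.differentiable one_ne_zero) (b.repr t)).hasFDerivAt.comp_hasDerivAt t
      (b.repr.toContinuousLinearEquiv.hasFDerivAt (x := t)).hasDerivAt
    simpa using h
  have h := HasCompactSupport.enorm_le_lintegral_Ici_deriv (f := f ∘ b.repr)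
    (hf.comp b.repr.contDiff) (hc.comp_homeomorph b.repr.toHomeomorph) (b.repr.symm x)
  simp only [Function.comp_apply, LinearIsometryEquiv.apply_symm_apply] at h
  refine h.trans ((setLIntegral_le_lintegral _ _).trans ?_)
  rw [eLpNorm_one_eq_lintegral_enorm]
  refine le_trans ?_ (b.measurePreserving_repr.lintegral_comp
    (hf.continuous_fderiv one_ne_zero).enorm.measurable).le
  refine lintegral_mono fun t => ?_
  rw [(hd t).deriv]
  refine (ContinuousLinearMap.le_opENorm _ _).trans ?_
  have hb : ‖b.repr 1‖₊ = 1 := by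
    exact (b.repr.nnnorm_map (1 : ℝ)).trans nnnorm_one
  simp [enorm_eq_nnnorm, hb]

theorem fk_sob (n : ℕ) (hn : 0 < n) : ∃ C : NNReal,
    ∀ f : EuclideanSpace ℝ (Fin n) → ℝ, ContDiff ℝ 1 f → HasCompactSupport f →
      eLpNorm f 1 volume ≤ C * eLpNorm (fderiv ℝ f) 1 volume *
        volume (Function.support f) ^ ((1 : ℝ) / n) := by
  have key : ∀ f : EuclideanSpace ℝ (Fin n) → ℝ,
      eLpNorm f 1 volume = eLpNorm f 1 (volume.restrict (Function.support f)) := by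
    intro f
    rw [eLpNorm_one_eq_lintegral_enorm, eLpNorm_one_eq_lintegral_enorm]
    exact (setLIntegral_eq_of_support_subset (by intro x; simp)).symm
  rcases Nat.lt_or_ge 1 n with h1 | h1
  · have hn1 : (1 : NNReal) < n := by exact_mod_cast h1
    have hq : NNReal.HolderConjugate (n : NNReal) (NNReal.conjExponent n) :=
      NNReal.HolderConjugate.conjExponent hn1
    set q := NNReal.conjExponent (n : NNReal)
    refine ⟨eLpNormLESNormFDerivOneConst (volume : Measure (EuclideanSpace ℝ (Fin n))) q,
      fun f hf hc => ?_⟩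
    have hs := eLpNorm_le_eLpNorm_fderiv_one volume hf hc (p := q) (by simpa using hq)
    have hq1 : (1 : ENNReal) ≤ q := by exact_mod_cast hq.symm.lt.le
    have hqi : (1 : ℝ) - 1 / q = 1 / n := by
      have := hq.coe.inv_add_inv_eq_one
      simp only [NNReal.coe_natCast] at this
      rw [one_div, one_div]; linarith
    rw [key]
    refine (eLpNorm_le_eLpNorm_mul_rpow_measure_univ hq1
      hf.continuous.aestronglyMeasurable).trans ?_
    simp only [Measure.restrict_apply_univ, ENNReal.toReal_one, div_one, ENNReal.coe_toReal, hqi]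
    gcongr
    exact (eLpNorm_mono_measure _ Measure.restrict_le_self).trans hs
  · obtain rfl : n = 1 := by omega
    refine ⟨1, fun f hf hc => ?_⟩
    rw [key, eLpNorm_one_eq_lintegral_enorm]
    refine (lintegral_mono (fun x => fk_sup f hf hc x)).trans ?_
    simp

theorem stmt3 (n : ℕ) (hn : 0 < n) (p : ℝ) (hp : 1 ≤ p) :
    ∃ c > (0 : ℝ), ∀ f : EuclideanSpace ℝ (Fin n) → ℝ,
      ContDiff ℝ (⊤ : ℕ∞) f → HasCompactSupport f →
      ∫ x, |f x| ≤
        c * (volume (Function.support f)).toReal ^ ((1 : ℝ) / n + 1 - 1 / p) *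
          (∫ x, ‖fderiv ℝ f x‖ ^ p) ^ (1 / p) := by
  obtain ⟨C, hC⟩ := fk_sob n hn
  refine ⟨C + 1, by positivity, fun f hf' hc => ?_⟩
  have hf : ContDiff ℝ 1 f := hf'.of_le (by exact_mod_cast le_top)
  have hp0 : 0 < p := by linarith
  have hfd : Continuous (fderiv ℝ f) := hf.continuous_fderiv one_ne_zero
  have hpt : (ENNReal.ofReal p).toReal = p := ENNReal.toReal_ofReal hp0.le
  have hmem : MemLp (fderiv ℝ f) (ENNReal.ofReal p) volume :=
    hfd.memLp_of_hasCompactSupport (hc.fderiv ℝ)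
  have hH := fk_holder hn f hf (ENNReal.ofReal p) (by simpa using hp)
  have hS := hC f hf hc
  have hfin : volume (Function.support f) ≠ ⊤ :=
    ((measure_mono (subset_tsupport f)).trans_lt hc.isCompact.measure_lt_top).ne
  rw [hpt] at hH
  have e1 : ∫ x, |f x| = (eLpNorm f 1 volume).toReal := by
    rw [eLpNorm_one_eq_lintegral_enorm,
      ← integral_norm_eq_lintegral_enorm hf.continuous.aestronglyMeasurable]
    rfl
  have hI : 0 ≤ ∫ x, ‖fderiv ℝ f x‖ ^ p := integral_nonneg fun x => by positivity
  have e2 : eLpNorm (fderiv ℝ f) (ENNReal.ofReal p) volume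
      = ENNReal.ofReal ((∫ x, ‖fderiv ℝ f x‖ ^ p) ^ (1 / p)) := by
    rw [hmem.eLpNorm_eq_integral_rpow_norm (by simpa using hp0) (by simp), hpt, one_div]
  have hexp1 : (0 : ℝ) ≤ 1 / n := by positivity
  have hexp2 : (0 : ℝ) ≤ 1 - 1 / p := by
    rw [sub_nonneg, div_le_one hp0]; exact hp
  have hall : eLpNorm f 1 volume ≤ C * volume (Function.support f) ^ ((1 : ℝ) / n + 1 - 1 / p) *
      ENNReal.ofReal ((∫ x, ‖fderiv ℝ f x‖ ^ p) ^ (1 / p)) := by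
    refine hS.trans ?_
    rw [add_sub_assoc, ENNReal.rpow_add_of_nonneg _ _ hexp1 hexp2, ← e2]
    calc _ ≤ C * (eLpNorm (fderiv ℝ f) (ENNReal.ofReal p) volume *
      volume (Function.support f) ^ (1 - 1 / p)) * volume (Function.support f) ^ ((1 : ℝ) / n) := by
          gcongr
      _ = _ := by ring
  rw [e1]
  refine (ENNReal.toReal_mono ?_ hall).trans ?_
  · refine ENNReal.mul_ne_top (ENNReal.mul_ne_top ENNReal.coe_ne_top ?_) ENNReal.ofReal_ne_top
    exact ENNReal.rpow_ne_top_of_nonneg (by linarith) hfin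
  · rw [ENNReal.toReal_mul, ENNReal.toReal_mul, ENNReal.toReal_ofReal (by positivity),
      ← ENNReal.toReal_rpow, ENNReal.coe_toReal]
    gcongr
    linarith
end
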